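/- Monotonicity of the Green's-function filter's absolute value: Fix σ > 0 and γ ∈ ℝ, and define g : ℝ \ {0} → ℝ by g(t) = π e^{γ t} (1 − erf(σ t/2 + γ/σ)) for t > 0 and g(t) = π e^{γ t} (1 + erf(σ t/2 + γ/σ)) for t < 0. Then g is strictly decreasing on (0, ∞) and strictly increasing on (−∞, 0). In particular, g(t) ≤ π(1 − erf(γ/σ)) for all t > 0 and g(t) ≤ π(1 + erf(γ/σ)) for all t < 0. -/

import Mathlib

noncomputable section

/-- The error function `erf(x) = (2/√π) ∫₀ˣ e^{-u²} du`. -/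
def erf (x : ℝ) : ℝ := (2 / Real.sqrt Real.pi) * ∫ u in (0 : ℝ)..x, Real.exp (-u ^ 2)

/-- The absolute value `|f_σ(t)|` of the approximate Green's-function filter:
`g(t) = π e^{γt}(1 - erf(σt/2 + γ/σ))` for `t > 0` and
`g(t) = π e^{γt}(1 + erf(σt/2 + γ/σ))` for `t < 0`. -/
def filterAbs (σ γ : ℝ) (t : ℝ) : ℝ :=
  if 0 < t then Real.pi * Real.exp (γ * t) * (1 - erf (σ * t / 2 + γ / σ))
  else Real.pi * Real.exp (γ * t) * (1 + erf (σ * t / 2 + γ / σ))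

theorem erf_neg (x : ℝ) : erf (-x) = -erf x := by
  have h := intervalIntegral.integral_comp_neg (a := 0) (b := x) fun u : ℝ => Real.exp (-u ^ 2)
  simp only [neg_zero, neg_sq] at h
  rw [erf, erf, h, intervalIntegral.integral_symm, mul_neg]

theorem hasDerivAt_erf (x : ℝ) :
    HasDerivAt erf (2 / Real.sqrt Real.pi * Real.exp (-x ^ 2)) x := by
  have hc : Continuous fun u : ℝ => Real.exp (-u ^ 2) := by fun_prop
  exact (hc.integral_hasStrictDerivAt 0 x).hasDerivAt.const_mul _

theorem strictMono_erf : StrictMono erf :=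
  strictMono_of_hasDerivAt_pos hasDerivAt_erf fun _ => by positivity

theorem tendsto_erf_atTop : Filter.Tendsto erf Filter.atTop (nhds 1) := by
  have hi : MeasureTheory.Integrable fun u : ℝ => Real.exp (-u ^ 2) := by
    simpa using integrable_exp_neg_mul_sq one_pos
  have hv : ∫ u in Set.Ioi (0 : ℝ), Real.exp (-u ^ 2) = Real.sqrt Real.pi / 2 := by
    simpa using integral_gaussian_Ioi 1
  have h := (MeasureTheory.intervalIntegral_tendsto_integral_Ioi 0 hi.integrableOn
    Filter.tendsto_id).const_mul (2 / Real.sqrt Real.pi)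
  rw [hv] at h
  have hp : Real.sqrt Real.pi ≠ 0 := by positivity
  have h1 : 2 / Real.sqrt Real.pi * (Real.sqrt Real.pi / 2) = 1 := by field_simp
  rw [h1] at h
  exact h

theorem erf_lt_one (x : ℝ) : erf x < 1 :=
  (strictMono_erf (lt_add_one x)).trans_le
    (strictMono_erf.monotone.ge_of_tendsto tendsto_erf_atTop _)

/-- The Mills ratio bound for the complementary error function. -/
theorem mul_one_sub_erf_lt (x : ℝ) :
    x * (1 - erf x) < Real.exp (-x ^ 2) / Real.sqrt Real.pi := by
  have hp : 0 < Real.sqrt Real.pi := by positivity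
  rcases le_or_gt x 0 with hx | hx
  · exact (mul_nonpos_of_nonpos_of_nonneg hx (sub_nonneg.2 (erf_lt_one x).le)).trans_lt
      (by positivity)
  let m : ℝ → ℝ := fun y => (1 - erf y) - Real.exp (-y ^ 2) / (y * Real.sqrt Real.pi)
  have hd : ∀ y : ℝ, 0 < y →
      HasDerivAt m (Real.exp (-y ^ 2) / (y ^ 2 * Real.sqrt Real.pi)) y := by
    intro y hy
    have h1 : HasDerivAt (fun u : ℝ => Real.exp (-u ^ 2)) (Real.exp (-y ^ 2) * (-(2 * y))) y := by
      simpa using ((hasDerivAt_pow 2 y).neg).exp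
    have h2 := ((hasDerivAt_erf y).const_sub 1).sub
      (h1.div ((hasDerivAt_id y).mul_const (Real.sqrt Real.pi)) (mul_pos hy hp).ne')
    refine h2.congr_deriv ?_
    simp only [id]
    field_simp
    ring
  have hm : StrictMonoOn m (Set.Ioi 0) := by
    refine strictMonoOn_of_hasDerivWithinAt_pos (convex_Ioi 0)
      (fun y hy => (hd y hy).continuousAt.continuousWithinAt)
      (fun y hy => (hd y (interior_subset hy)).hasDerivWithinAt) fun y hy => ?_
    have hy : 0 < y := interior_subset hy
    positivity
  have hlim : Filter.Tendsto m Filter.atTop (nhds 0) := by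
    have h1 : Filter.Tendsto (fun y : ℝ => Real.exp (-y ^ 2)) Filter.atTop (nhds 0) :=
      Real.tendsto_exp_neg_atTop_nhds_zero.comp (Filter.tendsto_pow_atTop two_ne_zero)
    simpa [m] using (tendsto_erf_atTop.const_sub 1).sub
      (h1.div_atTop (Filter.tendsto_id.atTop_mul_const hp))
  have hle : m (x + 1) ≤ 0 := by
    refine ge_of_tendsto hlim ?_
    filter_upwards [Filter.eventually_ge_atTop (x + 1)] with y hy
    exact hm.monotoneOn (Set.mem_Ioi.2 (by linarith)) (Set.mem_Ioi.2 (by linarith)) hy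
  have hlt : m x < 0 :=
    (hm (Set.mem_Ioi.2 hx) (Set.mem_Ioi.2 (by linarith)) (lt_add_one x)).trans_le hle
  calc x * (1 - erf x) < x * (Real.exp (-x ^ 2) / (x * Real.sqrt Real.pi)) :=
        mul_lt_mul_of_pos_left (sub_neg.1 hlt) hx
    _ = Real.exp (-x ^ 2) / Real.sqrt Real.pi := by field_simp

theorem strictAntiOn_exp_mul_one_sub_erf (σ γ : ℝ) (hσ : 0 < σ) :
    StrictAntiOn (fun t => Real.pi * Real.exp (γ * t) * (1 - erf (σ * t / 2 + γ / σ)))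
      (Set.Ici 0) := by
  have hd : ∀ t : ℝ, HasDerivAt
      (fun t => Real.pi * Real.exp (γ * t) * (1 - erf (σ * t / 2 + γ / σ)))
      (Real.pi * Real.exp (γ * t) * (γ * (1 - erf (σ * t / 2 + γ / σ)) -
        σ * (Real.exp (-(σ * t / 2 + γ / σ) ^ 2) / Real.sqrt Real.pi))) t := by
    intro t
    have h1 : HasDerivAt (fun t => Real.exp (γ * t)) (Real.exp (γ * t) * γ) t := by
      simpa using ((hasDerivAt_id t).const_mul γ).exp
    have h2 : HasDerivAt (fun t => σ * t / 2 + γ / σ) (σ / 2) t := by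
      simpa using (((hasDerivAt_id t).const_mul σ).div_const 2).add_const (γ / σ)
    refine ((h1.const_mul Real.pi).mul
      (((hasDerivAt_erf _).comp t h2).const_sub 1)).congr_deriv ?_
    simp only [Function.comp_apply]
    ring
  refine strictAntiOn_of_hasDerivWithinAt_neg (convex_Ici 0)
    (fun t _ => (hd t).continuousAt.continuousWithinAt)
    (fun t _ => (hd t).hasDerivWithinAt) fun t ht => ?_
  have ht : 0 ≤ t := interior_subset ht
  refine mul_neg_of_pos_of_neg (by positivity) (sub_neg.2 ?_)
  set x := σ * t / 2 + γ / σ with hx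
  have hγ : γ ≤ σ * x := by
    have : σ * x = σ ^ 2 * t / 2 + γ := by rw [hx]; field_simp
    rw [this]
    have : 0 ≤ σ ^ 2 * t / 2 := by positivity
    linarith
  calc γ * (1 - erf x) ≤ σ * x * (1 - erf x) :=
        mul_le_mul_of_nonneg_right hγ (sub_nonneg.2 (erf_lt_one x).le)
    _ = σ * (x * (1 - erf x)) := mul_assoc _ _ _
    _ < _ := mul_lt_mul_of_pos_left (mul_one_sub_erf_lt x) hσ

theorem filterAbs_of_pos {σ γ t : ℝ} (ht : 0 < t) :
    filterAbs σ γ t = Real.pi * Real.exp (γ * t) * (1 - erf (σ * t / 2 + γ / σ)) :=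
  if_pos ht

theorem filterAbs_of_neg {σ γ t : ℝ} (ht : t < 0) :
    filterAbs σ γ t = filterAbs σ (-γ) (-t) := by
  rw [filterAbs_of_pos (neg_pos.2 ht), filterAbs, if_neg ht.not_gt,
    show σ * -t / 2 + -γ / σ = -(σ * t / 2 + γ / σ) by ring, erf_neg, neg_mul_neg, sub_neg_eq_add]

theorem strictAntiOn_filterAbs (σ γ : ℝ) (hσ : 0 < σ) :
    StrictAntiOn (filterAbs σ γ) (Set.Ioi 0) :=
  ((strictAntiOn_exp_mul_one_sub_erf σ γ hσ).mono Set.Ioi_subset_Ici_self).congr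
    fun _ ht => (filterAbs_of_pos ht).symm

theorem filterAbs_le_of_pos {σ γ t : ℝ} (hσ : 0 < σ) (ht : 0 < t) :
    filterAbs σ γ t ≤ Real.pi * (1 - erf (γ / σ)) := by
  rw [filterAbs_of_pos ht]
  simpa using (strictAntiOn_exp_mul_one_sub_erf σ γ hσ Set.self_mem_Ici
    (Set.mem_Ici.2 ht.le) ht).le

/-- **Monotonicity of the Green's-function filter's absolute value** (Proposition S3):
for `σ > 0` and `γ ∈ ℝ`, the function `g = |f_σ|` is strictly decreasing on `(0, ∞)` and
strictly increasing on `(-∞, 0)`; in particular `g(t) ≤ π(1 - erf(γ/σ))` for `t > 0` and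
`g(t) ≤ π(1 + erf(γ/σ))` for `t < 0`. -/
theorem filterAbs_monotone (σ γ : ℝ) (hσ : 0 < σ) :
    StrictAntiOn (filterAbs σ γ) (Set.Ioi 0) ∧
    StrictMonoOn (filterAbs σ γ) (Set.Iio 0) ∧
    (∀ t : ℝ, 0 < t → filterAbs σ γ t ≤ Real.pi * (1 - erf (γ / σ))) ∧
    (∀ t : ℝ, t < 0 → filterAbs σ γ t ≤ Real.pi * (1 + erf (γ / σ))) := by
  refine ⟨strictAntiOn_filterAbs σ γ hσ, fun s hs t ht hst => ?_,
    fun t ht => filterAbs_le_of_pos hσ ht, fun t ht => ?_⟩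
  · rw [filterAbs_of_neg hs, filterAbs_of_neg ht]
    exact strictAntiOn_filterAbs σ (-γ) hσ (Set.mem_Ioi.2 (neg_pos.2 ht))
      (Set.mem_Ioi.2 (neg_pos.2 hs)) (neg_lt_neg hst)
  · rw [filterAbs_of_neg ht]
    simpa [neg_div, erf_neg] using filterAbs_le_of_pos (γ := -γ) hσ (neg_pos.2 ht)

end
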